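/- arXiv:0907.3723 — 2 statements merged into one kernel-verified Lean document; each statement's English description precedes it below -/
import Mathlib

section
/- Let q ≡ 1 (mod 5) and let A_0 be the affine curve y^5 = x^4(1-x)^3 over F_q. Then, as complex numbers, the number of pairs (x,y) ∈ F_q × F_q satisfying its equation equals q − Σ_χ ( −(1/q)·G(φ,χ)^2·G(φ,χ^3) ), where the sum runs over all nontrivial multiplicative characters χ of F_q^* with χ^5 = 1. -/
/-- The group of multiplicative characters of a finite field with values in `ℂ` is finite. -/
noncomputable instance {F : Type*} [Field F] [Fintype F] : Fintype (MulChar F ℂ) :=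
  Fintype.ofFinite _

open Finset in
/-- The Gauss sum `G(φ, χ) = ∑_{x ∈ F*} φ(x) χ(x)`. -/
noncomputable def gaussSum' {F : Type*} [Field F] [Fintype F] [DecidableEq F]
    (φ : AddChar F ℂ) (χ : MulChar F ℂ) : ℂ :=
  ∑ x : Fˣ, φ (x : F) * χ (x : F)

section PowerSolutions

variable {F : Type*} [Field F] [Fintype F]

/-- An element of `Fˣ` is an `n`-th power if and only if all characters of exponent `n`
are trivial on it. -/
lemma exists_units_pow_eq_iff_forall_mulChar (n : ℕ) (a : Fˣ) :
    (∃ b : Fˣ, b ^ n = a) ↔ ∀ χ : MulChar F ℂ, χ ^ n = 1 → χ a = 1 := by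
  let H : Subgroup Fˣ := (powMonoidHom n).range
  have hdual (χ : MulChar F ℂ) :
      χ ∈ (MulChar.subgroupOrderIsoSubgroupMulChar F ℂ H).ofDual ↔ χ ^ n = 1 := by
    rw [MulChar.mem_subgroupOrderIsoSubgroupMulChar_iff, MulChar.ext_iff]
    refine ⟨fun h b ↦ ?_, fun h m ⟨b, hb⟩ ↦ ?_⟩
    · rw [MulChar.pow_apply_coe, ← map_pow, MulChar.one_apply_coe, ← h (b ^ n) ⟨b, rfl⟩,
        Units.val_pow_eq_pow_val]
    · rw [← hb, powMonoidHom_apply, Units.val_pow_eq_pow_val, map_pow, ← MulChar.pow_apply_coe,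
        h b, MulChar.one_apply_coe]
  have hmem := MulChar.mem_subgroupOrderIsoSubgroupMulChar_symm_iff (m := a)
    (X := (MulChar.subgroupOrderIsoSubgroupMulChar F ℂ H).ofDual)
  rw [OrderDual.toDual_ofDual, OrderIso.symm_apply_apply] at hmem
  simp_rw [← hdual]
  exact hmem

open scoped Classical in
/-- The number of `n`-th roots of a unit `a` is the sum of `χ a` over the characters `χ` of
exponent `n`. -/
lemma card_units_pow_eq_sum_mulChar (n : ℕ) (a : Fˣ) :
    ((Finset.univ.filter fun b : Fˣ ↦ b ^ n = a).card : ℂ) =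
      ∑ χ ∈ Finset.univ.filter (fun χ : MulChar F ℂ ↦ χ ^ n = 1), χ a := by
  by_cases ha : ∃ b : Fˣ, b ^ n = a
  · have hχ := (exists_units_pow_eq_iff_forall_mulChar n a).mp ha
    obtain ⟨b, rfl⟩ := ha
    obtain ⟨e⟩ := MulChar.mulEquiv_units F ℂ
    rw [Finset.sum_congr rfl fun χ h ↦ hχ χ (Finset.mem_filter.mp h).2, Finset.sum_const,
      nsmul_one, Nat.cast_inj]
    refine Finset.card_equiv ((Equiv.mulRight b⁻¹).trans e.symm.toEquiv) fun c ↦ ?_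
    simp [← map_pow, mul_pow, mul_inv_eq_one]
  · have h := mt (exists_units_pow_eq_iff_forall_mulChar n a).mpr ha
    push Not at h ha
    obtain ⟨ψ, hψ, hψa⟩ := h
    rw [Finset.filter_false_of_mem fun b _ ↦ ha b, Finset.card_empty, Nat.cast_zero]
    refine (eq_zero_of_mul_eq_self_left hψa ?_).symm
    rw [Finset.mul_sum]
    refine Finset.sum_equiv (Equiv.mulLeft ψ) (fun χ ↦ ?_) fun χ _ ↦ ?_
    · simp [mul_pow, hψ]
    · simp

open scoped Classical in
/-- The number of `n`-th roots of `a` in a finite field, in terms of nontrivial characters. -/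
lemma card_pow_eq_one_add_sum_mulChar {n : ℕ} (hn : n ≠ 0) (a : F) :
    ((Finset.univ.filter fun y : F ↦ y ^ n = a).card : ℂ) =
      1 + ∑ χ ∈ Finset.univ.filter (fun χ : MulChar F ℂ ↦ χ ≠ 1 ∧ χ ^ n = 1), χ a := by
  obtain rfl | ha := eq_or_ne a 0
  · rw [Finset.card_eq_one.mpr ⟨0, by ext; simp [hn]⟩]
    simp [MulChar.map_zero]
  · lift a to Fˣ using ha.isUnit
    have hcard : (Finset.univ.filter fun y : F ↦ y ^ n = a).card =
        (Finset.univ.filter fun b : Fˣ ↦ b ^ n = a).card := by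
      refine (Finset.card_bij (fun (b : Fˣ) _ ↦ (b : F)) (fun b hb ↦ ?_)
        (fun _ _ _ _ h ↦ Units.ext h) fun y hy ↦ ?_).symm
      · rw [Finset.mem_filter_univ] at hb ⊢
        rw [← hb, Units.val_pow_eq_pow_val]
      · rw [Finset.mem_filter_univ] at hy
        have hy' : y ≠ 0 := fun h ↦ a.ne_zero (by rw [← hy, h, zero_pow hn])
        exact ⟨Units.mk0 y hy', by simp [Units.ext_iff, hy], rfl⟩
    have hfilter : Finset.univ.filter (fun χ : MulChar F ℂ ↦ χ ^ n = 1) =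
        insert 1 (Finset.univ.filter fun χ : MulChar F ℂ ↦ χ ≠ 1 ∧ χ ^ n = 1) := by
      ext χ
      by_cases h : χ = 1 <;> simp [h]
    rw [hcard, card_units_pow_eq_sum_mulChar, hfilter, Finset.sum_insert (by simp),
      MulChar.one_apply_coe]

open scoped Classical in
/-- The number of points of the affine curve `yⁿ = xᵏ(1-x)ˡ` in terms of Jacobi sums. -/
lemma card_pow_eq_mul_pow_eq_add_sum_jacobiSum {n k l : ℕ} (hn : n ≠ 0) (hk : k ≠ 0)
    (hl : l ≠ 0) :
    (Nat.card {pt : F × F // pt.2 ^ n = pt.1 ^ k * (1 - pt.1) ^ l} : ℂ) =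
      Fintype.card F + ∑ χ ∈ Finset.univ.filter (fun χ : MulChar F ℂ ↦ χ ≠ 1 ∧ χ ^ n = 1),
        jacobiSum (χ ^ k) (χ ^ l) := by
  have hfiber : Nat.card {pt : F × F // pt.2 ^ n = pt.1 ^ k * (1 - pt.1) ^ l} =
      ∑ x : F, (Finset.univ.filter fun y : F ↦ y ^ n = x ^ k * (1 - x) ^ l).card := by
    rw [Nat.card_eq_fintype_card, Fintype.card_subtype]
    simp_rw [Finset.card_filter]
    exact Fintype.sum_prod_type _
  rw [hfiber, Nat.cast_sum]
  simp_rw [card_pow_eq_one_add_sum_mulChar hn]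
  rw [Finset.sum_add_distrib, Finset.sum_comm]
  simp [jacobiSum, MulChar.pow_apply' _ hk, MulChar.pow_apply' _ hl]

end PowerSolutions

section GaussSums

variable {F : Type*} [Field F] [Fintype F]

/-- The Gauss sum over `Fˣ` agrees with Mathlib's Gauss sum over `F`. -/
lemma gaussSum'_eq_gaussSum [DecidableEq F] (φ : AddChar F ℂ) (χ : MulChar F ℂ) :
    gaussSum' φ χ = gaussSum χ φ := by
  rw [gaussSum', gaussSum]
  simp_rw [mul_comm (φ _)]
  refine Fintype.sum_of_injective (fun x : Fˣ ↦ (x : F)) Units.val_injective _ _ (fun x hx ↦ ?_)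
    fun _ ↦ rfl
  rw [χ.map_nonunit fun h ↦ hx h, zero_mul]

/-- If `χ` has odd exponent, then `g(χ) g(χ⁻¹) = #F`. -/
lemma gaussSum_mul_gaussSum_inv_of_odd {φ : AddChar F ℂ} (hφ : φ ≠ 1) {χ : MulChar F ℂ}
    (hχ : χ ≠ 1) {n : ℕ} (hn : Odd n) (hχn : χ ^ n = 1) :
    gaussSum χ φ * gaussSum χ⁻¹ φ = Fintype.card F := by
  have hneg : χ⁻¹ (-1) = 1 := by
    have h := MulChar.pow_apply_coe χ n (-1)
    rw [hχn, MulChar.one_apply_coe, Units.val_neg, Units.val_one, ← map_pow, hn.neg_one_pow] at h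
    rw [MulChar.inv_apply', inv_neg_one, ← h]
  rw [← mul_gaussSum_inv_eq_gaussSum χ⁻¹ φ, hneg, one_mul,
    gaussSum_mul_gaussSum_eq_card hχ (AddChar.IsPrimitive.of_ne_one hφ)]

/-- For `χ` of order five, `J(χ⁴, χ³) = g(χ³)² g(χ⁴) / #F`. -/
lemma jacobiSum_pow_four_pow_three {φ : AddChar F ℂ} (hφ : φ ≠ 1) {χ : MulChar F ℂ}
    (hχ : χ ≠ 1) (hχ5 : χ ^ 5 = 1) :
    jacobiSum (χ ^ 4) (χ ^ 3) =
      1 / (Fintype.card F : ℂ) * gaussSum (χ ^ 3) φ ^ 2 * gaussSum (χ ^ 4) φ := by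
  have hmul : χ ^ 4 * χ ^ 3 = χ ^ 2 := by
    rw [← pow_add, show 4 + 3 = 5 + 2 from rfl, pow_add, hχ5, one_mul]
  have hinv : (χ ^ 2)⁻¹ = χ ^ 3 := inv_eq_of_mul_eq_one_right (by rw [← pow_add, hχ5])
  have hne : χ ^ 2 ≠ 1 := fun h ↦ hχ <| by
    rwa [show 5 = 2 + 2 + 1 from rfl, pow_succ, pow_add, h, one_mul, one_mul] at hχ5
  have hcard := gaussSum_mul_gaussSum_inv_of_odd hφ hne (n := 5) (by decide)
    (by rw [← pow_mul, mul_comm, pow_mul, hχ5, one_pow])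
  have hJ := jacobiSum_mul_nontrivial (hmul ▸ hne) φ
  rw [hmul] at hJ
  rw [hinv] at hcard
  have hq : (Fintype.card F : ℂ) ≠ 0 := Nat.cast_ne_zero.mpr Fintype.card_ne_zero
  field_simp
  linear_combination gaussSum (χ ^ 3) φ * hJ - jacobiSum (χ ^ 4) (χ ^ 3) * hcard

end GaussSums

open scoped Classical in
/-- Let `F` be a finite field with `q ≡ 1 (mod 5)` elements of
characteristic `p ≠ 5` and let `φ` be a nontrivial additive character of `F` with values
in `ℂ`. The number of pairs `(x, y) ∈ F × F` with `y⁵ = x⁴(1-x)³` equals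
`q - ∑_χ (-(1/q) G(φ,χ)² G(φ,χ³))`, the sum running over nontrivial multiplicative
characters `χ` of `F` with `χ⁵ = 1`. -/
theorem stmt_3 {F : Type*} [Field F] [Fintype F] [DecidableEq F] (hchar : ringChar F ≠ 5)
    (hq : Fintype.card F % 5 = 1) (φ : AddChar F ℂ) (hφ : φ ≠ 1) :
    (Nat.card {pt : F × F // pt.2 ^ 5 = pt.1 ^ 4 * (1 - pt.1) ^ 3} : ℂ) =
      (Fintype.card F : ℂ) -
        ∑ χ ∈ Finset.univ.filter (fun χ : MulChar F ℂ => χ ≠ 1 ∧ χ ^ 5 = 1),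
          (-(1 / (Fintype.card F : ℂ)) * gaussSum' φ χ ^ 2 * gaussSum' φ (χ ^ 3)) := by
  rw [card_pow_eq_mul_pow_eq_add_sum_jacobiSum (by decide) (by decide) (by decide),
    sub_eq_add_neg, ← Finset.sum_neg_distrib]
  congr 1
  refine Finset.sum_bij' (fun χ _ ↦ χ ^ 3) (fun χ _ ↦ χ ^ 2) ?_ ?_ ?_ ?_ ?_
  all_goals
    intro χ hχ
    obtain ⟨hχ1, hχ5⟩ := (Finset.mem_filter_univ χ).mp hχ
    have hχ6 : χ ^ 6 = χ := by rw [pow_succ, hχ5, one_mul]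
  · refine (Finset.mem_filter_univ _).mpr ⟨fun h ↦ hχ1 ?_, ?_⟩
    · rw [← hχ6, show 6 = 3 * 2 from rfl, pow_mul, h, one_pow]
    · rw [← pow_mul, mul_comm, pow_mul, hχ5, one_pow]
  · refine (Finset.mem_filter_univ _).mpr ⟨fun h ↦ hχ1 ?_, ?_⟩
    · rw [← hχ6, show 6 = 2 * 3 from rfl, pow_mul, h, one_pow]
    · rw [← pow_mul, mul_comm, pow_mul, hχ5, one_pow]
  · rw [← pow_mul, hχ6]
  · rw [← pow_mul, hχ6]
  · have hχ9 : (χ ^ 3) ^ 3 = χ ^ 4 := by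
      rw [← pow_mul, show 3 * 3 = 5 + 4 from rfl, pow_add, hχ5, one_mul]
    rw [jacobiSum_pow_four_pow_three hφ hχ1 hχ5, gaussSum'_eq_gaussSum, gaussSum'_eq_gaussSum, hχ9]
    ring
end

section
/- Let q ≡ 1 (mod 5), let λ ∈ F_q^* be a fifth power, let a, b be integers with 1 ≤ a, b ≤ 4, and for a multiplicative character χ of F_q^* set N(C_λ,χ) = Σ_{x ∈ F_q, x ≠ 0, x ≠ 1, x ≠ 1/λ} χ^a(x)·χ^b(1−x)·χ^{−b}(1−λx). Then for every nontrivial multiplicative character χ' of F_q^* with χ'^5 = 1, we have N(C_λ,χ') = N(C_λ,χ'^{−1}). -/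
/-- `N(C_λ, χ) = ∑_{x ∈ F, x ≠ 0, x ≠ 1, x ≠ 1/λ} χ^a(x) χ^b(1-x) χ^{-b}(1-λx)`. -/
noncomputable def Ncurve {F : Type*} [Field F] [Fintype F] (a b : ℕ)
    (lam : F) (χ : MulChar F ℂ) : ℂ :=
  letI := Classical.decEq F
  ∑ x ∈ Finset.univ.filter (fun x : F => x ≠ 0 ∧ x ≠ 1 ∧ x ≠ lam⁻¹),
    (χ ^ a) x * (χ ^ b) (1 - x) * (χ ^ (-(b : ℤ))) (1 - lam * x)

/-- A multiplicative character of exponent `n` is trivial on nonzero `n`-th powers. -/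
theorem MulChar.apply_pow_eq_one {F R : Type*} [Field F] [CommMonoidWithZero R]
    {χ : MulChar F R} {n : ℕ} (hχ : χ ^ n = 1) {c : F} (hc : c ≠ 0) : χ (c ^ n) = 1 := by
  have h : (χ ^ n) c = χ c ^ n := MulChar.pow_apply_coe χ n (Units.mk0 c hc)
  rw [map_pow, ← h, hχ, MulChar.one_apply hc.isUnit]

/-- The summand of `Ncurve` for `χ` at `x` is the summand for `χ⁻¹` at `(lam * x)⁻¹`. -/
theorem MulChar.mul_mul_eq_inv_apply {F : Type*} [Field F] (χ : MulChar F ℂ) {lam : F}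
    (hlam : lam ≠ 0) (hχ : χ lam = 1) (a b : ℕ) (ha : a ≠ 0) (hb : b ≠ 0) {x : F} (hx : x ≠ 0) :
    (χ ^ a) x * (χ ^ b) (1 - x) * (χ ^ (-(b : ℤ))) (1 - lam * x) =
      (χ⁻¹ ^ a) (lam * x)⁻¹ * (χ⁻¹ ^ b) (1 - (lam * x)⁻¹) *
        (χ⁻¹ ^ (-(b : ℤ))) (1 - lam * (lam * x)⁻¹) := by
  have e₁ : (1 - (lam * x)⁻¹)⁻¹ = -1 * (lam * x) * (1 - lam * x)⁻¹ := by
    rw [← inv_inv (-1 * (lam * x) * (1 - lam * x)⁻¹)]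
    congr 1
    simp only [mul_inv, inv_inv]
    field_simp
    ring
  have e₂ : 1 - lam * (lam * x)⁻¹ = -1 * (1 - x) * x⁻¹ := by
    field_simp
    ring
  have hx' : χ x * χ x⁻¹ = 1 := by rw [← map_mul, mul_inv_cancel₀ hx, map_one]
  have hneg : χ (-1) * χ (-1) = 1 := by rw [← map_mul]; simp
  simp only [zpow_neg, zpow_natCast, inv_pow, inv_inv, MulChar.inv_apply',
    MulChar.pow_apply' _ ha, MulChar.pow_apply' _ hb, e₁, e₂, map_mul, hχ, one_mul]
  calc _ = χ x ^ a * χ (1 - x) ^ b * χ (1 - lam * x)⁻¹ ^ b *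
        (χ (-1) * χ (-1)) ^ b * (χ x * χ x⁻¹) ^ b := by rw [hneg, hx']; simp
    _ = _ := by ring

/-- Let `F` be a finite field with `q ≡ 1 (mod 5)` elements of
characteristic `p ≠ 5`, let `λ ∈ F*` be a fifth power, and let `1 ≤ a, b ≤ 4`. Then for
every nontrivial multiplicative character `χ'` of `F` with `χ'⁵ = 1`, we have
`N(C_λ, χ') = N(C_λ, χ'⁻¹)`. -/
theorem stmt_8 {F : Type*} [Field F] [Fintype F] (hchar : ringChar F ≠ 5)
    (hq : Fintype.card F % 5 = 1) (lam : F) (hlam : lam ≠ 0)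
    (hlam5 : ∃ c : F, c ^ 5 = lam) (a b : ℕ) (ha1 : 1 ≤ a) (ha4 : a ≤ 4)
    (hb1 : 1 ≤ b) (hb4 : b ≤ 4) (χ' : MulChar F ℂ) (hχ' : χ' ≠ 1) (hχ'5 : χ' ^ 5 = 1) :
    Ncurve a b lam χ' = Ncurve a b lam χ'⁻¹ := by
  classical
  obtain ⟨c, rfl⟩ := hlam5
  have hχ : χ' (c ^ 5) = 1 := MulChar.apply_pow_eq_one hχ'5 (by rintro rfl; simp at hlam)
  generalize c ^ 5 = l at *
  have hinv (x : F) : (l * (l * x)⁻¹)⁻¹ = x := by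
    rw [mul_inv, inv_inv, inv_mul_cancel_left₀ hlam]
  have hmem (x : F) (hx : x ≠ 0 ∧ x ≠ 1 ∧ x ≠ l⁻¹) :
      (l * x)⁻¹ ≠ 0 ∧ (l * x)⁻¹ ≠ 1 ∧ (l * x)⁻¹ ≠ l⁻¹ := by
    obtain ⟨h0, h1, h2⟩ := hx
    refine ⟨by simp [hlam, h0], fun h => h2 ?_, fun h => h1 ?_⟩
    · rw [← hinv x, h, mul_one]
    · rw [← hinv x, h, mul_inv_cancel₀ hlam, inv_one]
  refine Finset.sum_bij' (fun x _ => (l * x)⁻¹) (fun x _ => (l * x)⁻¹)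
    (fun x hx => ?_) (fun x hx => ?_) (fun x _ => hinv x) (fun x _ => hinv x) (fun x hx => ?_)
  · simpa only [Finset.mem_filter, Finset.mem_univ, true_and] using hmem x (by simpa using hx)
  · simpa only [Finset.mem_filter, Finset.mem_univ, true_and] using hmem x (by simpa using hx)
  · simp only [Finset.mem_filter] at hx
    exact MulChar.mul_mul_eq_inv_apply χ' hlam hχ a b (by omega) (by omega) hx.2.1
end
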